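/- For every nonnegative integer n, the number of partitions of 11n + 6 is divisible by 11, i.e., p(11n + 6) ≡ 0 (mod 11). -/

import Mathlib

namespace RamanujanEleven

open PowerSeries

section EulerOperator

variable {A : Type*} [CommRing A]

/-- The Euler operator `X * d/dX` on formal power series. -/
noncomputable def theta (A : Type*) [CommRing A] : Derivation A A⟦X⟧ A⟦X⟧ :=
  (X : A⟦X⟧) • PowerSeries.derivative A

lemma coeff_theta (f : A⟦X⟧) (n : ℕ) : coeff n (theta A f) = n * coeff n f := by
  cases n with
  | zero => simp [theta]
  | succ n =>
    simp only [theta, Derivation.smul_apply, smul_eq_mul, coeff_succ_X_mul, coeff_derivative]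
    push_cast
    ring

lemma map_theta {B : Type*} [CommRing B] (φ : A →+* B) (f : A⟦X⟧) :
    map φ (theta A f) = theta B (map φ f) := by
  ext n
  simp [coeff_theta]

lemma constantCoeff_theta (f : A⟦X⟧) :
    constantCoeff (theta A f) = 0 := by
  rw [← coeff_zero_eq_constantCoeff_apply]
  simp [coeff_theta]

end EulerOperator

section EisensteinSeries

/-- The power series `1 + c ∑ σₖ(n) Xⁿ`. -/
noncomputable def eisen (A : Type*) [CommRing A] (c : ℤ) (k : ℕ) : A⟦X⟧ :=
  PowerSeries.mk fun n ↦ if n = 0 then 1 else ((c * ArithmeticFunction.sigma k n : ℤ) : A)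

lemma map_eisen {A B : Type*} [CommRing A] [CommRing B] (φ : A →+* B) (c : ℤ) (k : ℕ) :
    map φ (eisen A c k) = eisen B c k := by
  ext n
  simp [eisen, apply_ite φ]

lemma constantCoeff_eisen {A : Type*} [CommRing A] (c : ℤ) (k : ℕ) :
    constantCoeff (eisen A c k) = 1 := by
  rw [← coeff_zero_eq_constantCoeff_apply]
  simp [eisen]

end EisensteinSeries

section QExpansions

open UpperHalfPlane hiding I
open Derivative
open scoped Manifold MatrixGroups ModularForm Topology Real

local notation "𝕢" => Function.Periodic.qParam

/-- `f` is holomorphic on the upper half plane and is the sum of the series `a` in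
`q = exp (2πiτ)`. -/
def IsQSum (f : ℍ → ℂ) (a : ℂ⟦X⟧) : Prop :=
  MDiff f ∧ ∀ τ : ℍ, HasSum (fun m ↦ coeff m a • 𝕢 1 τ ^ m) (f τ)

namespace IsQSum

variable {f g : ℍ → ℂ} {a b : ℂ⟦X⟧}

lemma isBoundedAtImInfty (hf : IsQSum f a) : IsBoundedAtImInfty f :=
  isBoundedAtImInfty_of_hasSum_qExpansion one_pos hf.2

lemma periodic (hf : IsQSum f a) : Function.Periodic (f ∘ ofComplex) (1 : ℝ) := by
  intro w
  by_cases! hw : 0 < w.im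
  · have hw' : 0 < (w + (1 : ℝ)).im := by simpa using hw
    simp only [Function.comp_apply, ofComplex_apply_of_im_pos hw', ofComplex_apply_of_im_pos hw]
    refine (hf.2 _).unique ?_
    have h : 𝕢 1 (w + (1 : ℝ)) = 𝕢 1 w := by
      simp [Function.Periodic.qParam, mul_add, Complex.exp_add]
    have := hf.2 ⟨w, hw⟩
    simp only [← h] at this
    exact this
  · have hw' : (w + (1 : ℝ)).im ≤ 0 := by simpa using hw
    simp only [Function.comp_apply, ofComplex_apply_of_im_nonpos hw, ofComplex_apply_of_im_nonpos hw']

lemma analyticAt (hf : IsQSum f a) : AnalyticAt ℂ (cuspFunction 1 f) 0 :=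
  analyticAt_cuspFunction_zero one_pos hf.periodic hf.1 hf.isBoundedAtImInfty

lemma qExpansion_eq (hf : IsQSum f a) : qExpansion 1 f = a := by
  ext m
  have h1 := (hasFPowerSeriesOnBall_cuspFunction one_pos hf.analyticAt hf.2).hasFPowerSeriesAt
  have h2 := congrArg (FormalMultilinearSeries.coeff · m)
    (hf.analyticAt.hasFPowerSeriesAt.eq_formalMultilinearSeries h1)
  simpa [qExpansion_coeff, div_eq_inv_mul, FormalMultilinearSeries.coeff_ofScalars] using h2

lemma mul (hf : IsQSum f a) (hg : IsQSum g b) : IsQSum (f * g) (a * b) := by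
  have hd : MDiff (f * g) := hf.1.mul hg.1
  refine ⟨hd, fun τ ↦ ?_⟩
  have hper : Function.Periodic ((f * g) ∘ ofComplex) (1 : ℝ) := fun w ↦
    congrArg₂ (· * ·) (hf.periodic w) (hg.periodic w)
  have h := hasSum_qExpansion one_pos hper hd
    (hf.isBoundedAtImInfty.mul hg.isBoundedAtImInfty) τ
  rwa [qExpansion_mul hf.analyticAt hg.analyticAt, hf.qExpansion_eq, hg.qExpansion_eq] at h

lemma sub (hf : IsQSum f a) (hg : IsQSum g b) : IsQSum (f - g) (a - b) :=
  ⟨hf.1.sub hg.1, fun τ ↦ by simpa [sub_mul] using (hf.2 τ).sub (hg.2 τ)⟩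

lemma smul (hf : IsQSum f a) (c : ℂ) : IsQSum (c • f) (c • a) :=
  ⟨hf.1.const_smul c, fun τ ↦ by simpa [mul_assoc] using (hf.2 τ).mul_left c⟩

lemma normalizedDerivOfComplex (hf : IsQSum f a) : IsQSum (D f) (theta ℂ a) := by
  refine ⟨normalizedDerivOfComplex_mdifferentiable hf.1, fun τ ↦ ?_⟩
  set c := cuspFunction 1 f with hc
  have hdiff : DifferentiableOn ℂ c (Metric.ball 0 1) :=
    differentiableOn_cuspFunction_ball one_pos hf.periodic hf.1 hf.isBoundedAtImInfty
  have hq : 𝕢 1 τ ∈ Metric.ball (0 : ℂ) 1 := by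
    simpa using Function.Periodic.norm_qParam_lt_one one_pos τ.im_pos
  have hD : D f τ = 𝕢 1 τ * deriv c (𝕢 1 τ) := by
    have heq : f ∘ ofComplex = c ∘ 𝕢 1 := by
      ext z
      exact (Function.Periodic.eq_cuspFunction one_ne_zero hf.periodic z).symm
    have h1 : HasDerivAt c (deriv c (𝕢 1 τ)) (𝕢 1 τ) :=
      (hdiff.differentiableAt (Metric.isOpen_ball.mem_nhds hq)).hasDerivAt
    have h2 : HasDerivAt (𝕢 1) (𝕢 1 τ * (2 * π * Complex.I)) (τ : ℂ) := by
      have := ((hasDerivAt_id (τ : ℂ)).const_mul (2 * π * Complex.I)).cexp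
      have heq : 𝕢 1 = fun z ↦ Complex.exp (2 * π * Complex.I * z) := by
        ext z
        simp [Function.Periodic.qParam]
      simpa [heq] using this
    rw [Derivative.normalizedDerivOfComplex, heq, (h1.comp _ h2).deriv]
    field_simp [Complex.two_pi_I_ne_zero]
  have hT := Complex.hasSum_taylorSeries_on_ball (hdiff.deriv Metric.isOpen_ball) hq
  have hT' := hT.mul_left (𝕢 1 τ)
  have hcoeff : (fun n : ℕ ↦ 𝕢 1 τ * ((n.factorial : ℂ)⁻¹ • (𝕢 1 τ - 0) ^ n •
      iteratedDeriv n (deriv c) 0)) =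
      fun n ↦ coeff (n + 1) (theta ℂ a) • 𝕢 1 τ ^ (n + 1) := by
    funext n
    rw [coeff_theta, ← hf.qExpansion_eq, qExpansion_coeff, iteratedDeriv_succ', Nat.factorial_succ]
    have : (n.factorial : ℂ) ≠ 0 := by exact_mod_cast n.factorial_ne_zero
    have : (n + 1 : ℂ) ≠ 0 := by exact_mod_cast n.succ_ne_zero
    push_cast
    simp only [smul_eq_mul, sub_zero]
    field_simp
    rw [hc]
    ring
  rw [hcoeff, hasSum_nat_add_iff (f := fun n ↦ coeff n (theta ℂ a) • 𝕢 1 τ ^ n) 1] at hT'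
  simpa only [Finset.range_one, Finset.sum_singleton, coeff_theta, Nat.cast_zero, zero_mul,
    zero_smul, add_zero, hD] using hT'

end IsQSum

lemma eq_zero_of_slash_invariant {k : ℕ} (hk : k < 12) {f : ℍ → ℂ} {a : ℂ⟦X⟧} (hf : IsQSum f a)
    (hslash : ∀ γ : SL(2, ℤ), f ∣[(k : ℤ)] γ = f) (h0 : coeff 0 a = 0) : a = 0 := by
  let F : ModularForm 𝒮ℒ (k : ℤ) :=
    { toFun := f
      slash_action_eq' := by
        rintro _ ⟨γ, rfl⟩
        exact hslash γ
      holo' := hf.1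
      bdd_at_cusps' := by
        intro c hc
        rw [Subgroup.IsArithmetic.isCusp_iff_isCusp_SL2Z] at hc
        rw [OnePoint.isBoundedAt_iff_forall_SL2Z hc]
        intro γ _
        rw [hslash]
        exact hf.isBoundedAtImInfty }
  have hF : qExpansion 1 F = a := hf.qExpansion_eq
  have hF0 : F = 0 := by
    refine ModularForm.sturm_bound_levelOne_nat ?_
    rw [hF, Nat.div_eq_of_lt hk, Nat.cast_zero]
    refine zero_lt_one.trans_le (nat_le_order a 1 fun i hi ↦ ?_)
    rwa [Nat.lt_one_iff.mp hi]
  rw [← hF, hF0]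
  exact qExpansion_zero 1

lemma isQSum_E2 : IsQSum EisensteinSeries.E2 (eisen ℂ (-24) 1) := by
  refine ⟨E2_mdifferentiable, fun τ ↦ ?_⟩
  convert EisensteinSeries.hasSum_qExpansion_E2 (z := τ) using 3 with m
  · simp [eisen]
  · simp [Function.Periodic.qParam]

lemma isQSum_E {k : ℕ} (hk : 3 ≤ k) (hk2 : Even k) (c : ℤ)
    (hc : -(2 * k / bernoulli k) = c) : IsQSum (ModularForm.E hk) (eisen ℂ c (k - 1)) := by
  refine ⟨ModularFormClass.holo _, fun τ ↦ ?_⟩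
  convert ModularForm.hasSum_qExpansion (f := ModularForm.E hk) one_pos
    one_mem_strictPeriods_SL τ using 1
  funext m
  rw [EisensteinSeries.E_qExpansion_coeff hk hk2, eisen, coeff_mk, smul_eq_mul]
  congr 2
  have := congrArg (Rat.cast : ℚ → ℂ) hc
  push_cast at this ⊢
  rw [← this]

lemma IsQSum.serreDerivative {f : ℍ → ℂ} {a : ℂ⟦X⟧} (hf : IsQSum f a) (k : ℂ) :
    IsQSum (serreDerivative k f) (theta ℂ a - (k * 12⁻¹) • (eisen ℂ (-24) 1 * a)) := by
  convert hf.normalizedDerivOfComplex.sub ((isQSum_E2.mul hf).smul (k * 12⁻¹)) using 1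
  ext z
  simp [mul_assoc]

lemma isQSum_E₄ : IsQSum ModularForm.E₄ (eisen ℂ 240 3) :=
  isQSum_E _ ⟨2, rfl⟩ 240 (by norm_num [show bernoulli 4 = -1 / 30 by decide +kernel])

lemma isQSum_E₆ : IsQSum ModularForm.E₆ (eisen ℂ (-504) 5) :=
  isQSum_E _ ⟨3, rfl⟩ (-504) (by norm_num [show bernoulli 6 = 1 / 42 by decide +kernel])

lemma isQSum_E₁₀ : IsQSum (ModularForm.E (k := 10) (by norm_num)) (eisen ℂ (-264) 9) :=
  isQSum_E _ ⟨5, rfl⟩ (-264) (by norm_num [show bernoulli 10 = 5 / 66 by decide +kernel])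

lemma sub_slash (k : ℤ) (γ : SL(2, ℤ)) (f g : ℍ → ℂ) :
    (f - g) ∣[k] γ = f ∣[k] γ - g ∣[k] γ := by
  simp [sub_eq_add_neg, SlashAction.add_slash]

lemma E_slash {k : ℕ} (hk : 3 ≤ k) (γ : SL(2, ℤ)) :
    (ModularForm.E hk : ℍ → ℂ) ∣[(k : ℤ)] γ = ModularForm.E hk :=
  (ModularForm.E hk).slash_action_eq' _ ⟨γ, rfl⟩

lemma theta_eisen_four_complex :
    3 * theta ℂ (eisen ℂ 240 3) = eisen ℂ (-24) 1 * eisen ℂ 240 3 - eisen ℂ (-504) 5 := by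
  have h := eq_zero_of_slash_invariant (k := 6) (by norm_num)
    ((isQSum_E₄.serreDerivative ((4 : ℕ) : ℤ)).sub (isQSum_E₆.smul (-3⁻¹))) (fun γ ↦ ?_) ?_
  · have h3 : (C (3⁻¹ : ℂ)) * 3 = 1 := by
      rw [show (3 : ℂ⟦X⟧) = C 3 from (map_ofNat C 3).symm, ← map_mul]
      simp
    have h4 : (((4 : ℕ) : ℤ) : ℂ) * 12⁻¹ = 3⁻¹ := by norm_num
    rw [h4] at h
    simp only [smul_eq_C_mul, map_neg] at h
    linear_combination 3 * h + (eisen ℂ (-24) 1 * eisen ℂ 240 3 - eisen ℂ (-504) 5) * h3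
  · rw [sub_slash, ModularForm.SL_smul_slash, E_slash]
    congr 1
    exact serreDerivative_slash_invariant isQSum_E₄.1 (E_slash _ γ)
  · norm_num [constantCoeff_theta, constantCoeff_eisen]

lemma theta_eisen_six_complex :
    2 * theta ℂ (eisen ℂ (-504) 5) = eisen ℂ (-24) 1 * eisen ℂ (-504) 5 - eisen ℂ 240 3 ^ 2 := by
  have h := eq_zero_of_slash_invariant (k := 8) (by norm_num)
    ((isQSum_E₆.serreDerivative ((6 : ℕ) : ℤ)).sub ((isQSum_E₄.mul isQSum_E₄).smul (-2⁻¹)))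
    (fun γ ↦ ?_) ?_
  · have h3 : (C (2⁻¹ : ℂ)) * 2 = 1 := by
      rw [show (2 : ℂ⟦X⟧) = C 2 from (map_ofNat C 2).symm, ← map_mul]
      simp
    have h4 : (((6 : ℕ) : ℤ) : ℂ) * 12⁻¹ = 2⁻¹ := by norm_num
    rw [h4] at h
    simp only [smul_eq_C_mul, map_neg] at h
    linear_combination 2 * h + (eisen ℂ (-24) 1 * eisen ℂ (-504) 5 - eisen ℂ 240 3 ^ 2) * h3
  · rw [sub_slash, ModularForm.SL_smul_slash]
    congr 1
    · exact serreDerivative_slash_invariant isQSum_E₆.1 (E_slash _ γ)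
    · congr 1
      refine (ModularForm.mul_slash_SL2 4 4 γ _ _).trans ?_
      congr 1 <;> exact E_slash _ γ
  · norm_num [constantCoeff_theta, constantCoeff_eisen]

lemma eisen_mul_eisen_complex :
    eisen ℂ 240 3 * eisen ℂ (-504) 5 = eisen ℂ (-264) 9 := by
  have h := eq_zero_of_slash_invariant (k := 10) (by norm_num)
    ((isQSum_E₄.mul isQSum_E₆).sub isQSum_E₁₀) (fun γ ↦ ?_) ?_
  · exact sub_eq_zero.mp h
  · rw [sub_slash, E_slash]
    congr 1
    refine (ModularForm.mul_slash_SL2 4 6 γ _ _).trans ?_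
    congr 1 <;> exact E_slash _ γ
  · simp [constantCoeff_eisen]

end QExpansions
section IntegralIdentities

lemma map_intCast_injective : Function.Injective (map (Int.castRingHom ℂ)) :=
  map_injective _ (RingHom.injective_int _)

lemma theta_eisen_four :
    3 * theta ℤ (eisen ℤ 240 3) = eisen ℤ (-24) 1 * eisen ℤ 240 3 - eisen ℤ (-504) 5 :=
  map_intCast_injective (by simpa [map_theta, map_eisen, _root_.map_ofNat (map (Int.castRingHom ℂ))] using theta_eisen_four_complex)

lemma theta_eisen_six :
    2 * theta ℤ (eisen ℤ (-504) 5) = eisen ℤ (-24) 1 * eisen ℤ (-504) 5 - eisen ℤ 240 3 ^ 2 :=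
  map_intCast_injective (by simpa [map_theta, map_eisen, _root_.map_ofNat (map (Int.castRingHom ℂ))] using theta_eisen_six_complex)

lemma eisen_four_mul_eisen_six : eisen ℤ 240 3 * eisen ℤ (-504) 5 = eisen ℤ (-264) 9 :=
  map_intCast_injective (by simpa [map_eisen] using eisen_mul_eisen_complex)

end IntegralIdentities

section PartitionSeries

/-- The generating function of the partition function. -/
noncomputable def partitionSeries (A : Type*) [CommRing A] : A⟦X⟧ :=
  PowerSeries.mk fun n ↦ (Fintype.card (Nat.Partition n) : A)

/-- The power series `∑ σ(n) Xⁿ`. -/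
noncomputable def sigmaSeries (A : Type*) [CommRing A] : A⟦X⟧ :=
  PowerSeries.mk fun n ↦ (ArithmeticFunction.sigma 1 n : A)

/-- The Lambert term `(i + 1) X^(i+1) / (1 - X^(i+1))`. -/
noncomputable def lambertTerm (i : ℕ) : ℤ⟦X⟧ :=
  PowerSeries.mk fun n ↦ if n ≠ 0 ∧ i + 1 ∣ n then (i + 1 : ℤ) else 0

lemma lambertTerm_mul (i : ℕ) :
    lambertTerm i * (1 - X ^ (i + 1)) = (i + 1 : ℤ⟦X⟧) * X ^ (i + 1) := by
  ext n
  rw [mul_sub, mul_one, map_sub, coeff_mul_X_pow',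
    show (i + 1 : ℤ⟦X⟧) = C (i + 1 : ℤ) by simp, coeff_C_mul, coeff_X_pow]
  simp only [lambertTerm, coeff_mk]
  rcases lt_trichotomy n (i + 1) with h | rfl | h
  · have h1 : ¬ (n ≠ 0 ∧ i + 1 ∣ n) := fun ⟨h0, hd⟩ ↦
      absurd (Nat.le_of_dvd (Nat.pos_of_ne_zero h0) hd) (by omega)
    rw [if_neg h1, if_neg (by omega), if_neg (by omega)]
    simp
  · simp
  · have h1 : (n ≠ 0 ∧ i + 1 ∣ n) ↔ (n - (i + 1) ≠ 0 ∧ i + 1 ∣ n - (i + 1)) := by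
      rw [Nat.dvd_sub_self_right]
      omega
    rw [if_pos h.le, if_neg (by omega : n ≠ i + 1)]
    simp [h1]

lemma coeff_sum_lambertTerm {n : ℕ} {s : Finset ℕ} (hs : Finset.range n ⊆ s) :
    coeff n (∑ i ∈ s, lambertTerm i) = ArithmeticFunction.sigma 1 n := by
  rcases eq_or_ne n 0 with rfl | hn
  · simp [lambertTerm]
  · simp only [map_sum, lambertTerm, coeff_mk]
    rw [ArithmeticFunction.sigma_one_apply, ← Finset.sum_subset hs]
    · simp only [hn, ne_eq, not_false_eq_true, true_and]
      rw [Nat.divisors, ← Finset.sum_filter, Nat.cast_sum, Finset.sum_filter, Finset.sum_filter,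
        Finset.sum_Ico_eq_sum_range]
      simp [add_comm]
    · intro i _ hi
      rw [if_neg]
      rintro ⟨_, hd⟩
      have := Nat.le_of_dvd (Nat.pos_of_ne_zero hn) hd
      simp at hi
      omega

lemma theta_prod {s : Finset ℕ} {h : ℕ → ℤ⟦X⟧} (hh : ∀ i, h i * (1 - X ^ (i + 1)) = 1) :
    theta ℤ (∏ i ∈ s, h i) = (∑ i ∈ s, lambertTerm i) * ∏ i ∈ s, h i := by
  have hterm (i : ℕ) : theta ℤ (h i) = lambertTerm i * h i := by
    have hX : theta ℤ (X ^ (i + 1)) = (i + 1 : ℤ⟦X⟧) * X ^ (i + 1) := by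
      ext n
      rw [coeff_theta, show (i + 1 : ℤ⟦X⟧) = C (i + 1 : ℤ) by simp, coeff_C_mul, coeff_X_pow]
      split_ifs with hn <;> simp [hn]
    have h1 := congrArg (theta ℤ) (hh i)
    rw [Derivation.leibniz, map_sub, Derivation.map_one_eq_zero, hX] at h1
    simp only [smul_eq_mul] at h1
    linear_combination h i * h1 - theta ℤ (h i) * hh i - (h i) ^ 2 * lambertTerm_mul i +
      h i * lambertTerm i * hh i
  classical
  induction s using Finset.induction_on with
  | empty => simp
  | insert i s hi ih =>
    rw [Finset.prod_insert hi, Finset.sum_insert hi, Derivation.leibniz, ih, hterm]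
    simp only [smul_eq_mul]
    ring

open scoped PowerSeries.WithPiTopology in
lemma theta_partitionSeries_int :
    theta ℤ (partitionSeries ℤ) = sigmaSeries ℤ * partitionSeries ℤ := by
  let : TopologicalSpace ℤ := ⊥
  have : DiscreteTopology ℤ := ⟨rfl⟩
  have hprod : HasProd (fun i ↦ ∑' j : ℕ, X ^ ((i + 1) * j)) (partitionSeries ℤ) := by
    simpa [Nat.Partition.restricted, partitionSeries] using
      Nat.Partition.hasProd_powerSeriesMk_card_restricted ℤ (fun _ ↦ True)
  have hh (i : ℕ) : (∑' j : ℕ, (X : ℤ⟦X⟧) ^ ((i + 1) * j)) * (1 - X ^ (i + 1)) = 1 := by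
    simp only [pow_mul]
    exact WithPiTopology.tsum_pow_mul_one_sub_of_constantCoeff_eq_zero (by simp)
  rw [HasProd, WithPiTopology.tendsto_iff_coeff_tendsto] at hprod
  ext n
  have hev : ∀ᶠ s : Finset ℕ in Filter.atTop, ∀ m ∈ Finset.range (n + 1),
      coeff m (∏ i ∈ s, ∑' j : ℕ, (X : ℤ⟦X⟧) ^ ((i + 1) * j)) = coeff m (partitionSeries ℤ) := by
    rw [Filter.eventually_all_finset]
    intro m _
    have := hprod m
    rw [nhds_discrete, Filter.tendsto_pure] at this
    exact this
  obtain ⟨s, hs, hsn⟩ := (hev.and (Filter.eventually_ge_atTop (Finset.range n))).exists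
  have hθ := congrArg (coeff n) (theta_prod (s := s) hh)
  rw [coeff_theta, hs n (by simp), coeff_mul] at hθ
  rw [coeff_theta, hθ, coeff_mul]
  refine Finset.sum_congr rfl fun ij hij ↦ ?_
  have hij := Finset.HasAntidiagonal.mem_antidiagonal.mp hij
  rw [hs ij.2 (Finset.mem_range.mpr (by omega)), coeff_sum_lambertTerm
    ((Finset.range_mono (by omega)).trans hsn)]
  simp [sigmaSeries]

end PartitionSeries
section Discriminant

lemma theta_pow {A : Type*} [CommRing A] (f : A⟦X⟧) (n : ℕ) :
    theta A (f ^ n) = n * f ^ (n - 1) * theta A f := by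
  rw [Derivation.leibniz_pow]
  simp [mul_assoc]

lemma eisen_two_eq : eisen ℤ (-24) 1 = 1 - 24 * sigmaSeries ℤ := by
  ext n
  rw [show (24 : ℤ⟦X⟧) = C 24 from (map_ofNat C 24).symm, map_sub, coeff_C_mul, coeff_one]
  by_cases hn : n = 0 <;> simp [eisen, sigmaSeries, hn]

/-- The product formula for the discriminant, in terms of the partition function. -/
lemma discriminant_mul_partitionSeries :
    (eisen ℤ 240 3 ^ 3 - eisen ℤ (-504) 5 ^ 2) * partitionSeries ℤ ^ 24 = 1728 * X := by
  have hU : theta ℤ ((eisen ℤ 240 3 ^ 3 - eisen ℤ (-504) 5 ^ 2) * partitionSeries ℤ ^ 24) =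
      (eisen ℤ 240 3 ^ 3 - eisen ℤ (-504) 5 ^ 2) * partitionSeries ℤ ^ 24 := by
    have h4 := theta_eisen_four
    have h6 := theta_eisen_six
    rw [eisen_two_eq] at h4 h6
    rw [Derivation.leibniz, map_sub, theta_pow, theta_pow, theta_pow, theta_partitionSeries_int]
    simp only [smul_eq_mul]
    push_cast
    linear_combination (exp := 1) partitionSeries ℤ ^ 24 * eisen ℤ 240 3 ^ 2 * h4 -
      partitionSeries ℤ ^ 24 * eisen ℤ (-504) 5 * h6
  ext n
  have hn := congrArg (coeff n) hU
  rw [coeff_theta] at hn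
  rw [show (1728 : ℤ⟦X⟧) = C 1728 from (map_ofNat C 1728).symm, coeff_C_mul, coeff_X]
  split_ifs with h1
  · subst h1
    have h0 : constantCoeff (partitionSeries ℤ) = 1 := by
      rw [← coeff_zero_eq_constantCoeff_apply]
      simp [partitionSeries]
    simp [coeff_one_mul, coeff_one_pow, constantCoeff_eisen, h0]
    simp [eisen]
  · have : (n : ℤ) - 1 ≠ 0 := by
      rw [sub_ne_zero]
      exact_mod_cast h1
    have h2 : ((n : ℤ) - 1) * coeff n ((eisen ℤ 240 3 ^ 3 - eisen ℤ (-504) 5 ^ 2) *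
        partitionSeries ℤ ^ 24) = 0 := by
      linear_combination hn
    simpa [this] using h2

end Discriminant

section ModEleven

lemma eleven_eq_zero : (11 : (ZMod 11)⟦X⟧) = 0 := by
  rw [show (11 : (ZMod 11)⟦X⟧) = C 11 from (map_ofNat C 11).symm, show (11 : ZMod 11) = 0 by rfl,
    map_zero]

lemma theta_mul_pow_eleven_mul (f g : (ZMod 11)⟦X⟧) (n : ℕ) :
    theta (ZMod 11) (f * g ^ (11 * n)) = theta (ZMod 11) f * g ^ (11 * n) := by
  rw [Derivation.leibniz, theta_pow]
  push_cast
  rw [eleven_eq_zero]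
  simp [mul_comm]

lemma exists_theta_eq_pow_five {P Q R : (ZMod 11)⟦X⟧}
    (hQ : 3 * theta (ZMod 11) Q = P * Q - R) (hR : 2 * theta (ZMod 11) R = P * R - Q ^ 2)
    (hQR : Q * R = 1) : ∃ G, (Q ^ 3 - R ^ 2) ^ 5 = theta (ZMod 11) G := by
  have h11 := eleven_eq_zero
  have hP : 5 * P = 3 * Q ^ 3 + 2 * R ^ 2 := by
    have h := congrArg (theta (ZMod 11)) hQR
    rw [Derivation.leibniz, Derivation.map_one_eq_zero] at h
    simp only [smul_eq_mul] at h
    linear_combination 6 * h - 2 * R * hQ - 3 * Q * hR - 5 * P * hQR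
  have hQ' : theta (ZMod 11) Q = 9 * (Q ^ 4 - R) := by
    linear_combination 15 * hQ + 3 * Q * hP + 6 * R * hQR - 4 * theta (ZMod 11) Q * h11
  have hR' : theta (ZMod 11) R = 9 * (R ^ 3 - Q ^ 2) := by
    linear_combination 50 * hR + 10 * R * hP + 30 * Q ^ 2 * hQR +
      (R ^ 3 - Q ^ 2 - 9 * theta (ZMod 11) R) * h11
  have hcancel (f : (ZMod 11)⟦X⟧) (k : ℕ) : f * (Q * R) ^ k = f := by rw [hQR, one_pow, mul_one]
  refine ⟨5 * Q ^ 12 + 5 * Q ^ 7 + 4 * Q ^ 2 + 3 * R ^ 3 + 9 * R ^ 8, ?_⟩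
  have hsmul (m : ℕ) (f : (ZMod 11)⟦X⟧) : theta (ZMod 11) (m * f) = m * theta (ZMod 11) f := by
    rw [← nsmul_eq_mul, map_nsmul, nsmul_eq_mul]
  have h3 := hsmul 3 (R ^ 3)
  have h4 := hsmul 4 (Q ^ 2)
  have h5 := hsmul 5 (Q ^ 12)
  have h5' := hsmul 5 (Q ^ 7)
  have h9 := hsmul 9 (R ^ 8)
  push_cast at h3 h4 h5 h5' h9
  simp only [map_add, h3, h4, h5, h5', h9, theta_pow, hQ', hR']
  push_cast
  linear_combination -5 * hcancel (Q ^ 10) 2 + 10 * hcancel (Q ^ 5) 4 - 10 * hcancel 1 6 +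
    5 * hcancel (R ^ 5) 3 + 540 * hcancel (Q ^ 10) 1 + 315 * hcancel (Q ^ 5) 1 +
    72 * hcancel 1 1 + 81 * hcancel 1 2 + 648 * hcancel (R ^ 5) 2 +
    (-49 * Q ^ 15 + 20 * Q ^ 10 + 23 * Q ^ 5 + 13 + 52 * R ^ 5 - 59 * R ^ 10) * h11

end ModEleven
end RamanujanEleven

open PowerSeries RamanujanEleven in
theorem ramanujan_congruence_mod_eleven (n : ℕ) :
    11 ∣ Fintype.card (Nat.Partition (11 * n + 6)) := by
  let φ := Int.castRingHom (ZMod 11)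
  have h4 := congrArg (map φ) theta_eisen_four
  have h6 := congrArg (map φ) theta_eisen_six
  have h10 := congrArg (map φ) eisen_four_mul_eisen_six
  have hΔ := congrArg (map φ) discriminant_mul_partitionSeries
  have hp : map φ (partitionSeries ℤ) = partitionSeries (ZMod 11) := by
    ext n
    simp [partitionSeries]
  have hT : eisen (ZMod 11) (-264) 9 = 1 := by
    ext n
    have h264 : (264 : ZMod 11) = 0 := rfl
    simp [eisen, coeff_one, h264]
  simp only [map_mul, map_sub, map_pow, map_theta, map_eisen, _root_.map_ofNat, hp, map_X, hT]
    at h4 h6 h10 hΔ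
  obtain ⟨G, hG⟩ := exists_theta_eq_pow_five h4 h6 h10
  set p := partitionSeries (ZMod 11) with hpdef
  have hkey : X ^ 5 * p = theta (ZMod 11) (G * p ^ (11 * 11)) := by
    rw [theta_mul_pow_eleven_mul, ← hG]
    have h1728 : (1728 : (ZMod 11)⟦X⟧) = 1 := by linear_combination 157 * eleven_eq_zero
    rw [h1728, one_mul] at hΔ
    rw [← hΔ]
    ring
  have hc := congrArg (coeff (11 * n + 6 + 5)) hkey
  rw [coeff_X_pow_mul, coeff_theta, show ((11 * n + 6 + 5 : ℕ) : ZMod 11) = 0 by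
    rw [ZMod.natCast_eq_zero_iff]; omega, zero_mul, hpdef, partitionSeries, coeff_mk,
    ZMod.natCast_eq_zero_iff] at hc
  exact hc
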